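/- In any stepping sequence for m, each index i ∈ {1,…,m−1} occurs exactly C(m,i) − 1 times (where C(m,i) is the binomial coefficient), and any two consecutive entries of the sequence are distinct. -/

import Mathlib

open List

/-- The initial configuration `(1, 2, …, m)`. -/
def initConfig (m : ℕ) : List ℕ := (List.range m).map (· + 1)

/-- A move at index `i` (with `1 ≤ i ≤ m-1`) transposes the entries `q_i` and `q_{i+1}`
(one-indexed), i.e. the entries at zero-indexed positions `i-1` and `i`. -/
def swapAdj (q : List ℕ) (i : ℕ) : List ℕ :=
  (q.set (i - 1) (q.getD i 0)).set i (q.getD (i - 1) 0)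

/-- The prefix set `S_k(q) = {q_1, …, q_k}`. -/
def prefixSet (q : List ℕ) (k : ℕ) : Finset ℕ := (q.take k).toFinset

/-- The initial prefix sets `S_0 ⊂ S_1 ⊂ … ⊂ S_m` of the configuration `(1,…,m)`. -/
def initSets (m : ℕ) : List (Finset ℕ) :=
  (List.range (m + 1)).map (fun k => prefixSet (initConfig m) k)

/-- The sets generated by applying a sequence of moves starting from configuration `q`:
the `t`-th generated set is the prefix set of length `i_t` of the configuration
obtained after the `t`-th move. -/
def genSetsAux (q : List ℕ) : List ℕ → List (Finset ℕ)
  | [] => []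
  | i :: rest => prefixSet (swapAdj q i) i :: genSetsAux (swapAdj q i) rest

/-- The sets generated by the moves, starting from the initial configuration `(1,…,m)`. -/
def genSets (m : ℕ) (moves : List ℕ) : List (Finset ℕ) :=
  genSetsAux (initConfig m) moves

/-- `moves` is a stepping sequence for `m`: each move index lies in `{1,…,m-1}`, and the
initial prefix sets `S_0,…,S_m` together with the generated sets list every subset of
`{1,…,m}` exactly once. -/
def IsSteppingSeq (m : ℕ) (moves : List ℕ) : Prop :=
  (∀ i ∈ moves, 1 ≤ i ∧ i ≤ m - 1) ∧
  (initSets m ++ genSets m moves).Perm (Finset.Icc 1 m).powerset.toList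

theorem swapAdj_perm {q : List ℕ} {i : ℕ} (hi : i < q.length) : (swapAdj q i).Perm q := by
  have h : i - 1 < q.length := by omega
  unfold swapAdj
  rw [List.getD_eq_getElem _ _ hi, List.getD_eq_getElem _ _ h]
  exact List.set_set_perm h hi

theorem length_swapAdj (q : List ℕ) (i : ℕ) : (swapAdj q i).length = q.length := by
  simp [swapAdj]

theorem swapAdj_swapAdj {q : List ℕ} {i : ℕ} (h1 : 1 ≤ i) (hi : i < q.length) :
    swapAdj (swapAdj q i) i = q := by
  have h : i - 1 < q.length := by omega
  apply List.ext_getElem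
  · simp [length_swapAdj]
  · intro n _ hn
    simp only [swapAdj, List.getElem_set, List.getD_eq_getElem, List.length_set, hi, h]
    grind

theorem take_swapAdj_of_lt {q : List ℕ} {i k : ℕ} (hik : i < k) :
    (swapAdj q i).take k = swapAdj (q.take k) i := by
  have h : i - 1 < k := by omega
  simp [swapAdj, List.take_set, List.getD_eq_getElem?_getD, hik, h]

theorem prefixSet_swapAdj_of_ne {q : List ℕ} {i k : ℕ} (hi : i < q.length) (hk : k ≠ i) :
    prefixSet (swapAdj q i) k = prefixSet q k := by
  unfold prefixSet
  rcases lt_or_gt_of_ne hk with hlt | hgt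
  · congr 1
    unfold swapAdj
    rw [List.take_set_of_le (by omega), List.take_set_of_le (by omega)]
  · rw [take_swapAdj_of_lt hgt]
    exact List.toFinset_eq_of_perm _ _ (swapAdj_perm (by simp; omega))

theorem card_prefixSet {q : List ℕ} (hq : q.Nodup) {k : ℕ} (hk : k ≤ q.length) :
    (prefixSet q k).card = k := by
  rw [prefixSet, List.toFinset_card_of_nodup (hq.sublist (List.take_sublist _ _))]
  simpa using hk

/-- The generated sets have as cardinalities the indices of the moves. -/
theorem map_card_genSetsAux {q : List ℕ} (hq : q.Nodup) {G : List ℕ}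
    (hG : ∀ i ∈ G, i < q.length) : (genSetsAux q G).map Finset.card = G := by
  induction G generalizing q with
  | nil => rfl
  | cons i G ih =>
    have hi : i < q.length := hG i (by simp)
    have hq' := (swapAdj_perm hi).nodup_iff.2 hq
    rw [genSetsAux, List.map_cons, card_prefixSet hq' (by rw [length_swapAdj]; omega),
      ih hq' fun j hj => by rw [length_swapAdj]; exact hG j (by simp [hj])]

/-- If the generated sets are new and pairwise distinct, no move directly follows itself. -/
theorem isChain_ne_of_nodup_genSetsAux {q : List ℕ} {L : List (Finset ℕ)} {G : List ℕ}
    (hL : ∀ k ≤ q.length, prefixSet q k ∈ L) (hG : ∀ i ∈ G, 1 ≤ i ∧ i < q.length)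
    (hnd : (L ++ genSetsAux q G).Nodup) : G.IsChain (· ≠ ·) := by
  induction G generalizing q L with
  | nil => exact .nil
  | cons i G ih =>
    obtain ⟨h1, hi⟩ := hG i (by simp)
    have htail : G.IsChain (· ≠ ·) := by
      refine ih (q := swapAdj q i) (L := L ++ [prefixSet (swapAdj q i) i]) ?_ ?_ ?_
      · intro k hk
        rw [length_swapAdj] at hk
        by_cases hki : k = i
        · simp [hki]
        · rw [prefixSet_swapAdj_of_ne hi hki]
          exact List.mem_append_left _ (hL k hk)
      · intro j hj
        rw [length_swapAdj]
        exact hG j (by simp [hj])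
      · simpa [genSetsAux] using hnd
    cases G with
    | nil => exact .singleton i
    | cons j G =>
      refine List.isChain_cons_cons.2 ⟨?_, htail⟩
      rintro rfl
      rw [genSetsAux, genSetsAux, swapAdj_swapAdj h1 hi] at hnd
      exact List.disjoint_of_nodup_append hnd (hL i hi.le) (by simp)

theorem length_initConfig (m : ℕ) : (initConfig m).length = m := by
  simp [initConfig]

theorem nodup_initConfig (m : ℕ) : (initConfig m).Nodup :=
  List.nodup_range.map (add_left_injective 1)

theorem map_card_initSets (m : ℕ) : (initSets m).map Finset.card = List.range (m + 1) := by
  rw [initSets, List.map_map]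
  conv_rhs => rw [← List.map_id (List.range (m + 1))]
  refine List.map_congr_left fun k hk => ?_
  refine card_prefixSet (nodup_initConfig m) ?_
  rw [length_initConfig]
  exact Nat.lt_succ_iff.1 (List.mem_range.1 hk)

theorem count_map_card_powerset (s : Finset ℕ) (i : ℕ) :
    (s.powerset.toList.map Finset.card).count i = s.card.choose i := by
  rw [← Finset.card_powersetCard, Finset.powersetCard_eq_filter, ← Multiset.coe_count,
    ← Multiset.map_coe, Finset.coe_toList, Multiset.count_map, Finset.card_def,
    Finset.filter_val]
  simp only [eq_comm]

/-- In any stepping sequence for `m`, each index `i ∈ {1,…,m-1}` occurs exactly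
`C(m,i) - 1` times, and any two consecutive entries are distinct. -/
theorem stepping_count_and_consecutive (m : ℕ) (hm : 2 ≤ m) (G : List ℕ)
    (hG : IsSteppingSeq m G) :
    (∀ i, 1 ≤ i → i ≤ m - 1 → G.count i = Nat.choose m i - 1) ∧
    (∀ t, t + 1 < G.length → G.getD t 0 ≠ G.getD (t + 1) 0) := by
  obtain ⟨hmem, hperm⟩ := hG
  constructor
  · intro i _ hi
    have h := (hperm.map Finset.card).count_eq i
    rw [count_map_card_powerset, List.map_append, List.count_append, map_card_initSets,
      genSets, map_card_genSetsAux (nodup_initConfig m) fun j hj => by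
        rw [length_initConfig]; have := hmem j hj; omega,
      List.count_eq_one_of_mem List.nodup_range (List.mem_range.2 (by omega)),
      Nat.card_Icc, Nat.add_sub_cancel] at h
    omega
  · intro t ht
    have hchain : G.IsChain (· ≠ ·) := by
      refine isChain_ne_of_nodup_genSetsAux (q := initConfig m) (L := initSets m) ?_ ?_ ?_
      · intro k hk
        rw [length_initConfig] at hk
        exact List.mem_map.2 ⟨k, List.mem_range.2 (by omega), rfl⟩
      · intro j hj
        rw [length_initConfig]
        have := hmem j hj
        omega
      · exact hperm.nodup_iff.2 (Finset.nodup_toList _)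
    rw [List.getD_eq_getElem _ _ ht, List.getD_eq_getElem _ _ (by omega)]
    exact List.isChain_iff_getElem.1 hchain t ht
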